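/- arXiv:2202.00420 — 4 statements merged into one kernel-verified Lean document; each statement's English description precedes it below -/
import Mathlib

section
/- Assume the exact data is used (b^δ = b*), all proximal steps are exact (ε_k = 0 for every k), the set S* of saddle points of the exact Lagrangian is nonempty, and ω := 1 − τ_M(L + σ_M‖A‖²) ≥ 0. Then the primal–dual sequence (x_k, y_k) converges weakly to a pair in S*; in particular, (x_k) converges weakly to a minimizer of R + F over {x ∈ X : Ax = b*}. -/
open scoped RealInnerProductSpace ENNReal NNReal
open Filter Topology

noncomputable section

/-- The `ε`-subdifferential of an extended-real-valued function `R` at `x`: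
`∂_ε R (x) = {u : ∀ x', R x - R x' ≤ ⟪u, x - x'⟫ + ε}`, written without `EReal` subtraction. -/
def epsSubdiff {X : Type*} [NormedAddCommGroup X] [InnerProductSpace ℝ X]
    (R : X → EReal) (ε : ℝ) (x : X) : Set X :=
  {u | ∀ x' : X, R x + ((⟪u, x' - x⟫ - ε : ℝ) : EReal) ≤ R x'}

/-- Convexity for extended-real-valued functions. -/
def ERealConvex {X : Type*} [AddCommGroup X] [Module ℝ X] (R : X → EReal) : Prop :=
  ∀ x y : X, ∀ t : ℝ, 0 ≤ t → t ≤ 1 →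
    R (t • x + (1 - t) • y) ≤ (t : EReal) * R x + ((1 - t : ℝ) : EReal) * R y

/-- `R` is proper, convex and lower semicontinuous. -/
def ProperConvexLsc {X : Type*} [NormedAddCommGroup X] [InnerProductSpace ℝ X]
    (R : X → EReal) : Prop :=
  (∃ x, R x ≠ ⊤) ∧ (∀ x, R x ≠ ⊥) ∧ ERealConvex R ∧ LowerSemicontinuous R

/-- The Lagrangian `L_b(x,y) = R x + F x + ⟪y, A x - b⟫`. -/
def Lag {X Y : Type*} [NormedAddCommGroup X] [InnerProductSpace ℝ X]
    [NormedAddCommGroup Y] [InnerProductSpace ℝ Y]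
    (R : X → EReal) (F : X → ℝ) (A : X →L[ℝ] Y) (b : Y) (x : X) (y : Y) : EReal :=
  R x + ((F x + ⟪y, A x - b⟫ : ℝ) : EReal)

/-- Saddle points of the Lagrangian `L_b`. -/
def IsSaddle {X Y : Type*} [NormedAddCommGroup X] [InnerProductSpace ℝ X]
    [NormedAddCommGroup Y] [InnerProductSpace ℝ Y]
    (R : X → EReal) (F : X → ℝ) (A : X →L[ℝ] Y) (b : Y) (p : X × Y) : Prop :=
  ∀ x : X, ∀ y : Y, Lag R F A b p.1 y ≤ Lag R F A b x p.2

/-- Weak convergence of a sequence in a Hilbert space. -/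
def WeakTendsto {X : Type*} [NormedAddCommGroup X] [InnerProductSpace ℝ X]
    (u : ℕ → X) (l : X) : Prop :=
  ∀ w : X, Tendsto (fun k => ⟪u k, w⟫) atTop (nhds ⟪l, w⟫)

/-- `V(x,y) = ½‖x‖_T² + ½‖y‖_Σ²`, written via the inverses of the preconditioners. -/
def Vfun {X Y : Type*} [NormedAddCommGroup X] [InnerProductSpace ℝ X]
    [NormedAddCommGroup Y] [InnerProductSpace ℝ Y]
    (Tinv : X →L[ℝ] X) (Sginv : Y →L[ℝ] Y) (z : X × Y) : ℝ :=
  1 / 2 * ⟪Tinv z.1, z.1⟫ + 1 / 2 * ⟪Sginv z.2, z.2⟫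

variable {X Y : Type*}
  [NormedAddCommGroup X] [InnerProductSpace ℝ X] [CompleteSpace X]
  [NormedAddCommGroup Y] [InnerProductSpace ℝ Y] [CompleteSpace Y]

set_option linter.unusedSectionVars false

section ConvexAnalysis

lemma hasDerivAt_comp_line {F : X → ℝ} {F' : X → X}
    (hF : ∀ u, HasGradientAt F (F' u) u) (u d : X) (t : ℝ) :
    HasDerivAt (fun s : ℝ => F (u + s • d)) ⟪F' (u + t • d), d⟫ t := by
  have h1 : HasDerivAt (fun s : ℝ => u + s • d) d t := by
    simpa using ((hasDerivAt_id t).smul_const d).const_add u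
  have h2 := (hF (u + t • d)).hasFDerivAt.comp_hasDerivAt t h1
  rw [InnerProductSpace.toDual_apply_apply] at h2
  exact h2

lemma convex_gradient_le {F : X → ℝ} {F' : X → X} (hconv : ConvexOn ℝ Set.univ F)
    (hF : ∀ u, HasGradientAt F (F' u) u) (u v : X) :
    F u + ⟪F' u, v - u⟫ ≤ F v := by
  have hline : ConvexOn ℝ Set.univ (fun s : ℝ => F (u + s • (v - u))) := by
    have := hconv.comp_affineMap (AffineMap.lineMap u v : ℝ →ᵃ[ℝ] X)
    have e : (fun s : ℝ => F (u + s • (v - u))) = F ∘ AffineMap.lineMap u v := by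
      funext s
      simp [AffineMap.lineMap_apply, add_comm]
    rw [e]
    exact this
  have h := hline.le_slope_of_hasDerivAt (Set.mem_univ (0 : ℝ)) (Set.mem_univ (1 : ℝ))
    one_pos (hasDerivAt_comp_line hF u (v - u) 0)
  simp [slope_def_field] at h
  linarith

lemma lipschitz_gradient_le {F : X → ℝ} {F' : X → X} {L : ℝ}
    (hF : ∀ u, HasGradientAt F (F' u) u)
    (hlip : ∀ u v : X, ‖F' u - F' v‖ ≤ L * ‖u - v‖) (u d : X) :
    F (u + d) ≤ F u + ⟪F' u, d⟫ + L / 2 * ‖d‖ ^ 2 := by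
  have hder : ∀ t : ℝ, HasDerivAt
      (fun s : ℝ => F (u + s • d) - s * ⟪F' u, d⟫ - L / 2 * ‖d‖ ^ 2 * s ^ 2)
      (⟪F' (u + t • d), d⟫ - ⟪F' u, d⟫ - L * ‖d‖ ^ 2 * t) t := by
    intro t
    have := ((hasDerivAt_comp_line hF u d t).sub
      ((hasDerivAt_id t).mul_const ⟪F' u, d⟫)).sub
      ((hasDerivAt_pow 2 t).const_mul (L / 2 * ‖d‖ ^ 2))
    exact this.congr_deriv (by push_cast; ring)
  have hanti := antitoneOn_of_deriv_nonpos (convex_Icc (0 : ℝ) 1)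
    (fun t _ => (hder t).continuousAt.continuousWithinAt)
    (fun t _ => (hder t).differentiableAt.differentiableWithinAt) (by
      intro t ht
      rw [interior_Icc] at ht
      rw [(hder t).deriv, ← inner_sub_left]
      have h1 := real_inner_le_norm (F' (u + t • d) - F' u) d
      have h2 := hlip (u + t • d) u
      rw [add_sub_cancel_left, norm_smul, Real.norm_of_nonneg ht.1.le] at h2
      nlinarith [norm_nonneg d, mul_le_mul_of_nonneg_right h2 (norm_nonneg d)])
  have h := hanti (Set.left_mem_Icc.2 zero_le_one) (Set.right_mem_Icc.2 zero_le_one) zero_le_one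
  simp at h
  linarith

/-- A consequence of the Baillon–Haddad theorem that needs no division by the Lipschitz
constant. -/
lemma lipschitz_gradient_inner_ge {F : X → ℝ} {F' : X → X} {L : ℝ}
    (hconv : ConvexOn ℝ Set.univ F) (hF : ∀ u, HasGradientAt F (F' u) u)
    (hlip : ∀ u v : X, ‖F' u - F' v‖ ≤ L * ‖u - v‖) (u v w : X) :
    -(L / 4) * ‖w - u‖ ^ 2 ≤ ⟪F' u - F' v, w - v⟫ := by
  set d : X := (1 / 2 : ℝ) • (w - u) with hd
  have hw : w - v = (u - v) + (2 : ℝ) • d := by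
    rw [hd, smul_smul]; norm_num
  have hn : ‖w - u‖ ^ 2 = 4 * ‖d‖ ^ 2 := by
    rw [hd, norm_smul, mul_pow]; norm_num; ring
  have h1 := lipschitz_gradient_le hF hlip u d
  have h2 := lipschitz_gradient_le hF hlip v (-d)
  have h3 := convex_gradient_le hconv hF v (u + d)
  have h4 := convex_gradient_le hconv hF u (v + -d)
  rw [norm_neg] at h2
  rw [hw, hn]
  simp only [inner_sub_left, inner_add_right, inner_sub_right, inner_neg_right,
    inner_smul_right] at *
  linarith

end ConvexAnalysis

section WeakLimits

/-- Weak convergence along a filter. -/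
def WeakTendstoAlong (U : Filter ℕ) (u : ℕ → X) (l : X) : Prop :=
  ∀ w : X, Tendsto (fun k => ⟪u k, w⟫) U (𝓝 ⟪l, w⟫)

lemma exists_weakTendstoAlong (U : Ultrafilter ℕ) {u : ℕ → X} {C : ℝ} (hu : ∀ k, ‖u k‖ ≤ C) :
    ∃ l, WeakTendstoAlong (U : Filter ℕ) u l := by
  let f : ℕ → WeakDual ℝ X := fun k =>
    StrongDual.toWeakDual (InnerProductSpace.toDual ℝ X (u k))
  have hc := WeakDual.isCompact_closedBall (𝕜 := ℝ) (0 : StrongDual ℝ X) C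
  obtain ⟨φ, -, hφ⟩ := hc.ultrafilter_le_nhds' (U.map f)
    (Filter.mem_map.2 (Filter.univ_mem' fun k => by simpa [f] using hu k))
  refine ⟨(InnerProductSpace.toDual ℝ X).symm (WeakDual.toStrongDual φ), fun w => ?_⟩
  have h1 : Tendsto f U (𝓝 φ) := hφ
  have h2 := ((WeakDual.eval_continuous w).tendsto φ).comp h1
  rw [InnerProductSpace.toDual_symm_apply]
  exact h2

lemma mem_of_weakTendstoAlong {U : Filter ℕ} [U.NeBot] {s : Set X} (hs : Convex ℝ s)
    (hcl : IsClosed s) {u : ℕ → X} {l : X} (hu : ∀ᶠ k in U, u k ∈ s)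
    (hl : WeakTendstoAlong U u l) : l ∈ s := by
  by_contra hn
  obtain ⟨f, c, hfl, hfs⟩ := geometric_hahn_banach_point_closed hs hcl hn
  obtain ⟨w, rfl⟩ := (InnerProductSpace.toDual ℝ X).surjective f
  have h := hl w
  have : c ≤ ⟪l, w⟫ := by
    refine ge_of_tendsto h (hu.mono fun k hk => ?_)
    have := hfs _ hk
    rw [InnerProductSpace.toDual_apply_apply, real_inner_comm] at this
    exact this.le
  rw [InnerProductSpace.toDual_apply_apply, real_inner_comm] at hfl
  linarith

lemma ERealConvex.convex_le {R : X → EReal} (hR : ERealConvex R) (c : ℝ) :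
    Convex ℝ {u | R u ≤ (c : EReal)} := by
  intro a ha b hb s t hs ht hst
  obtain rfl : t = 1 - s := by linarith
  have h := hR a b s hs (by linarith)
  refine h.trans ?_
  calc (s : EReal) * R a + ((1 - s : ℝ) : EReal) * R b
      ≤ (s : EReal) * c + ((1 - s : ℝ) : EReal) * c :=
        add_le_add (mul_le_mul_of_nonneg_left ha (by exact_mod_cast hs))
          (mul_le_mul_of_nonneg_left hb (by exact_mod_cast ht))
    _ = c := by norm_cast; ring_nf

lemma ProperConvexLsc.le_of_weakTendstoAlong {R : X → EReal} (hR : ProperConvexLsc R)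
    {U : Filter ℕ} [U.NeBot] {u : ℕ → X} {l : X} (hl : WeakTendstoAlong U u l)
    {r : ℕ → ℝ} {c : ℝ} (hr : Tendsto r U (𝓝 c)) (hu : ∀ k, R (u k) ≤ (r k : EReal)) :
    R l ≤ (c : EReal) := by
  refine EReal.le_of_forall_lt_iff_le.1 fun z hz => ?_
  have hz' : c < z := by exact_mod_cast hz
  exact mem_of_weakTendstoAlong (hR.2.2.1.convex_le z) (hR.2.2.2.isClosed_preimage z)
    ((hr.eventually (gt_mem_nhds hz')).mono fun k hk =>
      (hu k).trans (by exact_mod_cast hk.le)) hl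

/-- If `u → l` weakly and `v → m` strongly, then `⟪u, v⟫ → ⟪l, m⟫`. -/
lemma WeakTendstoAlong.inner_tendsto {U : Filter ℕ} {u v : ℕ → X} {l m : X} {C : ℝ}
    (hu : ∀ k, ‖u k‖ ≤ C) (hl : WeakTendstoAlong U u l) (hv : Tendsto v U (𝓝 m)) :
    Tendsto (fun k => ⟪u k, v k⟫) U (𝓝 ⟪l, m⟫) := by
  have h0 : Tendsto (fun k => ⟪u k, v k - m⟫) U (𝓝 0) := by
    refine squeeze_zero_norm (a := fun k => C * ‖v k - m‖) (fun k => ?_) ?_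
    · exact (norm_inner_le_norm _ _).trans
        (mul_le_mul_of_nonneg_right (hu k) (norm_nonneg _))
    · have := (tendsto_iff_norm_sub_tendsto_zero.1 hv).const_mul C
      simpa using this
  have := h0.add (hl m)
  simpa [inner_sub_right] using this

lemma WeakTendstoAlong.of_sub_tendsto_zero {U : Filter ℕ} {u v : ℕ → X} {l : X}
    (hl : WeakTendstoAlong U u l) (h : Tendsto (fun k => v k - u k) U (𝓝 0)) :
    WeakTendstoAlong U v l := by
  intro w
  have h1 : Tendsto (fun k => ⟪v k - u k, w⟫) U (𝓝 ⟪(0 : X), w⟫) :=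
    h.inner tendsto_const_nhds
  have := h1.add (hl w)
  simpa [inner_sub_left] using this

lemma WeakTendstoAlong.map {U : Filter ℕ} {u : ℕ → X} {l : X} (hl : WeakTendstoAlong U u l)
    (B : X →L[ℝ] Y) : WeakTendstoAlong U (fun k => B (u k)) (B l) := by
  intro w
  simpa [ContinuousLinearMap.adjoint_inner_right] using hl (ContinuousLinearMap.adjoint B w)

lemma WeakTendstoAlong.unique {U : Filter ℕ} [U.NeBot] {u : ℕ → X} {l m : X}
    (hl : WeakTendstoAlong U u l) (hm : WeakTendstoAlong U u m) : l = m :=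
  ext_inner_right ℝ fun w => tendsto_nhds_unique (hl w) (hm w)

end WeakLimits

section Subdifferential

lemma ne_top_of_mem_epsSubdiff {R : X → EReal} (hR : ∃ x, R x ≠ ⊤) {u a : X}
    (h : u ∈ epsSubdiff R 0 a) : R a ≠ ⊤ := by
  obtain ⟨p, hp⟩ := hR
  intro ha
  have := h p
  rw [ha, EReal.top_add_coe] at this
  exact hp (top_le_iff.1 this)

lemma epsSubdiff_zero_monotone {R : X → EReal} (hR : ProperConvexLsc R) {u v a b : X}
    (hu : u ∈ epsSubdiff R 0 a) (hv : v ∈ epsSubdiff R 0 b) : 0 ≤ ⟪u - v, a - b⟫ := by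
  have ha := ne_top_of_mem_epsSubdiff hR.1 hu
  have hb := ne_top_of_mem_epsSubdiff hR.1 hv
  have h1 := hu b
  have h2 := hv a
  lift R a to ℝ using ⟨ha, hR.2.1 a⟩ with ra
  lift R b to ℝ using ⟨hb, hR.2.1 b⟩ with rb
  norm_cast at h1 h2
  simp only [inner_sub_left, inner_sub_right] at *
  linarith

end Subdifferential

section Saddle

lemma isSaddle_iff {R : X → EReal} (hR : ProperConvexLsc R) {F : X → ℝ} {A : X →L[ℝ] Y} {b : Y}
    {p : X} {q : Y} :
    IsSaddle R F A b (p, q) ↔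
      A p = b ∧ ∀ u, R p + (F p : EReal) ≤ R u + ((F u + ⟪q, A u - b⟫ : ℝ) : EReal) := by
  constructor
  · intro h
    have hp : R p ≠ ⊤ := by
      obtain ⟨u, hu⟩ := hR.1
      intro hp
      have := h u 0
      simp only [Lag, hp, EReal.top_add_coe] at this
      lift R u to ℝ using ⟨hu, hR.2.1 u⟩ with r
      exact absurd (top_le_iff.1 this) (by norm_cast)
    have hA : A p = b := by
      have := h p (q + (A p - b))
      simp only [Lag] at this
      lift R p to ℝ using ⟨hp, hR.2.1 p⟩ with r
      norm_cast at this
      rw [inner_add_left, real_inner_self_eq_norm_sq] at this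
      have h0 : ‖A p - b‖ ^ 2 = 0 := le_antisymm (by linarith) (sq_nonneg _)
      exact sub_eq_zero.1 (by simpa using h0)
    refine ⟨hA, fun u => ?_⟩
    have := h u 0
    simpa only [Lag, inner_zero_left, add_zero] using this
  · rintro ⟨hA, h⟩ u v
    have := h u
    simp only [Lag, hA, sub_self, inner_zero_right, add_zero]
    exact this

lemma IsSaddle.neg_gradient_mem {R : X → EReal} (hR : ProperConvexLsc R) {F : X → ℝ}
    {F' : X → X} {L : ℝ} (hF : ∀ u, HasGradientAt F (F' u) u)
    (hlip : ∀ u v : X, ‖F' u - F' v‖ ≤ L * ‖u - v‖) {A : X →L[ℝ] Y} {b : Y} {p : X} {q : Y}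
    (h : IsSaddle R F A b (p, q)) :
    -F' p - ContinuousLinearMap.adjoint A q ∈ epsSubdiff R 0 p := by
  obtain ⟨hA, h⟩ := (isSaddle_iff hR).1 h
  have hp : R p ≠ ⊤ := by
    obtain ⟨u, hu⟩ := hR.1
    intro hp
    have := h u
    rw [hp, EReal.top_add_coe] at this
    lift R u to ℝ using ⟨hu, hR.2.1 u⟩ with r
    exact absurd (top_le_iff.1 this) (by norm_cast)
  intro u
  by_cases hu : R u = ⊤
  · rw [hu]; exact le_top
  have key : ∀ t : ℝ, 0 < t → t ≤ 1 → (R p).toReal ≤ (R u).toReal + ⟪F' p, u - p⟫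
      + ⟪q, A (u - p)⟫ + L / 2 * ‖u - p‖ ^ 2 * t := by
    intro t ht ht1
    have h1 := h (t • u + (1 - t) • p)
    have h2 := hR.2.2.1 u p t ht.le ht1
    have h3 := h1.trans (add_le_add_left h2 _)
    have h4 := lipschitz_gradient_le hF hlip p (t • (u - p))
    have e : t • u + (1 - t) • p = p + t • (u - p) := by module
    rw [e] at h3
    have e2 : A (p + t • (u - p)) - b = t • A (u - p) := by
      rw [map_add, hA, map_smul, add_sub_cancel_left]
    rw [e2] at h3
    lift R u to ℝ using ⟨hu, hR.2.1 u⟩ with ru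
    lift R p to ℝ using ⟨hp, hR.2.1 p⟩ with rp
    norm_cast at h3
    rw [EReal.toReal_coe, EReal.toReal_coe]
    rw [inner_smul_right] at h3 h4
    rw [norm_smul, Real.norm_of_nonneg ht.le] at h4
    refine le_of_mul_le_mul_left ?_ ht
    nlinarith
  have hlim : Tendsto (fun t : ℝ => (R u).toReal + ⟪F' p, u - p⟫
      + ⟪q, A (u - p)⟫ + L / 2 * ‖u - p‖ ^ 2 * t) (𝓝[>] 0) (𝓝 ((R u).toReal + ⟪F' p, u - p⟫
      + ⟪q, A (u - p)⟫ + L / 2 * ‖u - p‖ ^ 2 * 0)) :=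
    (Continuous.tendsto (by fun_prop) _).mono_left nhdsWithin_le_nhds
  have hle := ge_of_tendsto hlim (by
    filter_upwards [Ioc_mem_nhdsGT (zero_lt_one (α := ℝ))] with t ht using key t ht.1 ht.2)
  lift R u to ℝ using ⟨hu, hR.2.1 u⟩ with ru
  lift R p to ℝ using ⟨hp, hR.2.1 p⟩ with rp
  norm_cast
  rw [EReal.toReal_coe, EReal.toReal_coe] at hle
  rw [inner_sub_left, inner_neg_left, ContinuousLinearMap.adjoint_inner_left]
  linarith

end Saddle

section QuadraticForms

/-- Upper bounds on a positive operator give lower bounds on its inverse. -/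
lemma inner_inverse_ge {T Tinv : X →L[ℝ] X} (hinv : ∀ u, T (Tinv u) = u)
    (hsa : ∀ u v : X, ⟪T u, v⟫ = ⟪u, T v⟫) {c : ℝ} (hc : 0 < c)
    (hpos : ∀ u : X, 0 ≤ ⟪T u, u⟫) (hle : ∀ u : X, ⟪T u, u⟫ ≤ c * ‖u‖ ^ 2) (v : X) :
    c⁻¹ * ‖v‖ ^ 2 ≤ ⟪Tinv v, v⟫ := by
  have h1 := hpos (Tinv v - c⁻¹ • v)
  have h2 := hsa v (Tinv v)
  have h3 := mul_le_mul_of_nonneg_left (hle v) (mul_nonneg (inv_pos.2 hc).le (inv_pos.2 hc).le)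
  rw [hinv, real_inner_self_eq_norm_sq] at h2
  have h4 : ⟪v, Tinv v⟫ = ⟪Tinv v, v⟫ := real_inner_comm _ _
  have h5 : c⁻¹ * c⁻¹ * (c * ‖v‖ ^ 2) = c⁻¹ * ‖v‖ ^ 2 := by field_simp
  simp only [map_sub, map_smul, hinv, inner_sub_left, inner_sub_right, inner_smul_left,
    inner_smul_right, real_inner_self_eq_norm_sq, h2, h4, RCLike.conj_to_real] at h1
  linarith

lemma inverse_symmetric {T Tinv : X →L[ℝ] X} (hinv : ∀ u, T (Tinv u) = u)
    (hsa : ∀ u v : X, ⟪T u, v⟫ = ⟪u, T v⟫) (u v : X) : ⟪Tinv u, v⟫ = ⟪u, Tinv v⟫ := by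
  rw [← hinv v, ← hsa, hinv, hinv]

lemma two_mul_inner_sub_eq {M : X →L[ℝ] X} (hsa : ∀ u v : X, ⟪M u, v⟫ = ⟪u, M v⟫) (a b : X) :
    2 * ⟪M (a - b), a⟫ = ⟪M a, a⟫ + ⟪M (a - b), a - b⟫ - ⟪M b, b⟫ := by
  have h1 : ⟪M a, b⟫ = ⟪M b, a⟫ := by rw [hsa, real_inner_comm]
  simp only [map_sub, inner_sub_left, inner_sub_right]
  linarith

lemma inner_sub_sub_inner_sub_eq {M : X →L[ℝ] X} (hsa : ∀ u v : X, ⟪M u, v⟫ = ⟪u, M v⟫)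
    (u p q : X) : ⟪M (u - p), u - p⟫ - ⟪M (u - q), u - q⟫ =
      ⟪M p, p⟫ - ⟪M q, q⟫ - 2 * ⟪u, M (p - q)⟫ := by
  have h1 : ⟪M u, p⟫ = ⟪u, M p⟫ := hsa _ _
  have h2 : ⟪M u, q⟫ = ⟪u, M q⟫ := hsa _ _
  have h3 : ⟪M p, u⟫ = ⟪u, M p⟫ := real_inner_comm _ _
  have h4 : ⟪M q, u⟫ = ⟪u, M q⟫ := real_inner_comm _ _
  simp only [map_sub, inner_sub_left, inner_sub_right]
  linarith

lemma tendsto_zero_of_mul_norm_sq_le {u : ℕ → X} {r : ℕ → ℝ} {c : ℝ} (hc : 0 < c)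
    (hr : Tendsto r atTop (𝓝 0)) (h : ∀ k, c * ‖u k‖ ^ 2 ≤ r k) :
    Tendsto u atTop (𝓝 0) := by
  have h1 : Tendsto (fun k => ‖u k‖ ^ 2) atTop (𝓝 0) := by
    refine squeeze_zero (g := fun k => c⁻¹ * r k) (fun k => sq_nonneg _) (fun k => ?_) ?_
    · rw [inv_mul_eq_div, le_div_iff₀ hc]
      linarith [h k]
    · simpa using hr.const_mul c⁻¹
  have h2 := h1.sqrt
  simp only [Real.sqrt_sq (norm_nonneg _), Real.sqrt_zero] at h2
  exact tendsto_zero_iff_norm_tendsto_zero.2 h2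

end QuadraticForms

section ForwardBackward

variable {R : X → EReal} {F : X → ℝ} {F' : X → X} {L : ℝ} {A : X →L[ℝ] Y} {b : Y}
  {M : X →L[ℝ] X} {W : Y →L[ℝ] Y} {x : ℕ → X} {y : ℕ → Y}

/-- The distance functional attached to the metric `M ⊕ W`. -/
def pdEnergy (M : X →L[ℝ] X) (W : Y →L[ℝ] Y) (x : ℕ → X) (y : ℕ → Y) (p : X × Y) (k : ℕ) : ℝ :=
  ⟪M (x k - p.1), x k - p.1⟫ + ⟪W (y k - p.2), y k - p.2⟫

lemma pdEnergy_succ_le (hR : ProperConvexLsc R) (hconv : ConvexOn ℝ Set.univ F)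
    (hF : ∀ u, HasGradientAt F (F' u) u) (hlip : ∀ u v : X, ‖F' u - F' v‖ ≤ L * ‖u - v‖)
    (hMsa : ∀ u v : X, ⟪M u, v⟫ = ⟪u, M v⟫) (hWsa : ∀ u v : Y, ⟪W u, v⟫ = ⟪u, W v⟫)
    (hML : ∀ u : X, L * ‖u‖ ^ 2 ≤ ⟪M u, u⟫)
    (hx : ∀ k, -M (x (k + 1) - x k) - F' (x k) - ContinuousLinearMap.adjoint A (y (k + 1))
      ∈ epsSubdiff R 0 (x (k + 1)))
    (hy : ∀ k, W (y (k + 1) - y k) = A (x (k + 1)) - b)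
    {p : X × Y} (hp : IsSaddle R F A b p) (k : ℕ) :
    pdEnergy M W x y p (k + 1) + 1 / 2 * ⟪M (x (k + 1) - x k), x (k + 1) - x k⟫
      + ⟪W (y (k + 1) - y k), y (k + 1) - y k⟫ ≤ pdEnergy M W x y p k := by
  obtain ⟨p, q⟩ := p
  have h1 := epsSubdiff_zero_monotone hR (hx k) (hp.neg_gradient_mem hR hF hlip)
  have h2 := lipschitz_gradient_inner_ge hconv hF hlip (x k) p (x (k + 1))
  have h3 := hML (x (k + 1) - x k)
  have h4 := two_mul_inner_sub_eq hMsa (x (k + 1) - p) (x k - p)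
  have h5 := two_mul_inner_sub_eq hWsa (y (k + 1) - q) (y k - q)
  rw [sub_sub_sub_cancel_right] at h4 h5
  have hA : A p = b := ((isSaddle_iff hR).1 hp).1
  have h6 : ⟪W (y (k + 1) - y k), y (k + 1) - q⟫ =
      ⟪ContinuousLinearMap.adjoint A (y (k + 1) - q), x (k + 1) - p⟫ := by
    rw [ContinuousLinearMap.adjoint_inner_left, map_sub A, hA, hy, real_inner_comm]
  have e : -M (x (k + 1) - x k) - F' (x k) - ContinuousLinearMap.adjoint A (y (k + 1))
      - (-F' p - ContinuousLinearMap.adjoint A q) = -M (x (k + 1) - x k) - (F' (x k) - F' p)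
      - ContinuousLinearMap.adjoint A (y (k + 1) - q) := by
    rw [map_sub (ContinuousLinearMap.adjoint A)]; abel
  rw [e, inner_sub_left, inner_sub_left, inner_neg_left] at h1
  simp only [pdEnergy]
  linarith

/-- Weak limits of the iterates are saddle points. -/
lemma isSaddle_of_weakTendstoAlong (hR : ProperConvexLsc R) (hconv : ConvexOn ℝ Set.univ F)
    (hF : ∀ u, HasGradientAt F (F' u) u) (hlip : ∀ u v : X, ‖F' u - F' v‖ ≤ L * ‖u - v‖)
    (hL : 0 ≤ L)
    (hx : ∀ k, -M (x (k + 1) - x k) - F' (x k) - ContinuousLinearMap.adjoint A (y (k + 1))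
      ∈ epsSubdiff R 0 (x (k + 1)))
    {U : Filter ℕ} [U.NeBot] {C D : ℝ} (hxC : ∀ k, ‖x k‖ ≤ C) (hyD : ∀ k, ‖y k‖ ≤ D)
    (hdx : Tendsto (fun k => x (k + 1) - x k) U (𝓝 0))
    (hdy : Tendsto (fun k => y (k + 1) - y k) U (𝓝 0))
    (hAx : Tendsto (fun k => A (x (k + 1)) - b) U (𝓝 0))
    {p : X} {q : Y} (hp : WeakTendstoAlong U x p) (hq : WeakTendstoAlong U y q) :
    IsSaddle R F A b (p, q) := by
  have hp1 : WeakTendstoAlong U (fun k => x (k + 1)) p := hp.of_sub_tendsto_zero hdx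
  have hq1 : WeakTendstoAlong U (fun k => y (k + 1)) q := hq.of_sub_tendsto_zero hdy
  have hA : A p = b := by
    refine (hp1.map A).unique fun w => ?_
    have := (hAx.inner (tendsto_const_nhds (x := w))).add_const ⟪b, w⟫
    simpa [inner_sub_left] using this
  refine (isSaddle_iff hR).2 ⟨hA, fun u => ?_⟩
  by_cases hu : R u = ⊤
  · rw [hu, EReal.top_add_coe]; exact le_top
  lift R u to ℝ using ⟨hu, hR.2.1 u⟩ with ru hru
  let r : ℕ → ℝ := fun k => ru + ⟪u - x (k + 1), M (x (k + 1) - x k)⟫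
    + (F u - F p - (⟪x k, F' p⟫ - ⟪p, F' p⟫)) - ⟪F' (x k), x (k + 1) - x k⟫
    + (⟪y (k + 1), A u - b⟫ - ⟪y (k + 1), A (x (k + 1)) - b⟫)
  have hle : ∀ k, R (x (k + 1)) ≤ (r k : EReal) := by
    intro k
    have h1 := hx k u
    have h2 := convex_gradient_le hconv hF (x k) u
    have h3 := convex_gradient_le hconv hF p (x k)
    lift R (x (k + 1)) to ℝ using ⟨ne_top_of_mem_epsSubdiff hR.1 (hx k), hR.2.1 _⟩ with s
    rw [← hru] at h1
    norm_cast at h1 ⊢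
    have h4 : ⟪u - x (k + 1), M (x (k + 1) - x k)⟫ = ⟪M (x (k + 1) - x k), u - x (k + 1)⟫ :=
      real_inner_comm _ _
    have h5 : ⟪x k, F' p⟫ = ⟪F' p, x k⟫ := real_inner_comm _ _
    have h6 : ⟪p, F' p⟫ = ⟪F' p, p⟫ := real_inner_comm _ _
    rw [inner_sub_left, inner_sub_left, inner_neg_left,
      ContinuousLinearMap.adjoint_inner_left, map_sub A] at h1
    simp only [r, h4, h5, h6]
    simp only [inner_sub_right] at h1 h2 h3 ⊢
    linarith
  have hgC : ∀ k, ‖F' (x k)‖ ≤ ‖F' p‖ + L * (C + ‖p‖) := by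
    intro k
    have h1 := hlip (x k) p
    have h2 := norm_sub_le (x k) p
    have h3 := norm_le_norm_add_norm_sub' (F' (x k)) (F' p)
    have h4 := mul_le_mul_of_nonneg_left (h2.trans (add_le_add_left (hxC k) _)) hL
    linarith
  have hlim : Tendsto r U (𝓝 (ru + 0 + (F u - F p - (⟪p, F' p⟫ - ⟪p, F' p⟫)) - 0
      + (⟪q, A u - b⟫ - ⟪q, (0 : Y)⟫))) := by
    have hM : Tendsto (fun k => M (x (k + 1) - x k)) U (𝓝 0) := by
      simpa only [map_zero, Function.comp_def] using (M.continuous.tendsto 0).comp hdx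
    have t1 : Tendsto (fun k => ⟪u - x (k + 1), M (x (k + 1) - x k)⟫) U (𝓝 0) := by
      have hw : WeakTendstoAlong U (fun k => u - x (k + 1)) (u - p) := fun w => by
        simpa [inner_sub_left] using (hp1 w).const_sub ⟪u, w⟫
      simpa using hw.inner_tendsto (C := ‖u‖ + C)
        (fun k => (norm_sub_le _ _).trans (add_le_add_right (hxC _) _)) hM
    have t2 : Tendsto (fun k => ⟪F' (x k), x (k + 1) - x k⟫) U (𝓝 0) := by
      refine squeeze_zero_norm (a := fun k => (‖F' p‖ + L * (C + ‖p‖)) * ‖x (k + 1) - x k‖)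
        (fun k => (norm_inner_le_norm _ _).trans
          (mul_le_mul_of_nonneg_right (hgC k) (norm_nonneg _))) ?_
      simpa using hdx.norm.const_mul (‖F' p‖ + L * (C + ‖p‖))
    exact (((tendsto_const_nhds.add t1).add
      (((hp (F' p)).sub_const _).const_sub _)).sub t2).add
      ((hq1 (A u - b)).sub (hq1.inner_tendsto (fun k => hyD _) hAx))
  have h := hR.le_of_weakTendstoAlong hp1 hlim hle
  lift R p to ℝ using ⟨ne_top_of_le_ne_top (EReal.coe_ne_top _) h, hR.2.1 _⟩ with rp
  norm_cast at h ⊢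
  rw [inner_zero_right] at h
  linarith

lemma exists_isSaddle_weakTendsto (hR : ProperConvexLsc R) (hconv : ConvexOn ℝ Set.univ F)
    (hF : ∀ u, HasGradientAt F (F' u) u) (hlip : ∀ u v : X, ‖F' u - F' v‖ ≤ L * ‖u - v‖)
    (hL : 0 ≤ L)
    (hMsa : ∀ u v : X, ⟪M u, v⟫ = ⟪u, M v⟫) (hWsa : ∀ u v : Y, ⟪W u, v⟫ = ⟪u, W v⟫)
    (hML : ∀ u : X, L * ‖u‖ ^ 2 ≤ ⟪M u, u⟫)
    {c s w : ℝ} (hc : 0 < c) (hw : 0 < w)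
    (hMA : ∀ u : X, c * ‖u‖ ^ 2 ≤ ⟪M u, u⟫ + s * ‖A u‖ ^ 2)
    (hWw : ∀ v : Y, w * ‖v‖ ^ 2 ≤ ⟪W v, v⟫)
    (hx : ∀ k, -M (x (k + 1) - x k) - F' (x k) - ContinuousLinearMap.adjoint A (y (k + 1))
      ∈ epsSubdiff R 0 (x (k + 1)))
    (hy : ∀ k, W (y (k + 1) - y k) = A (x (k + 1)) - b)
    (hS : ∃ p, IsSaddle R F A b p) :
    ∃ p q, IsSaddle R F A b (p, q) ∧ WeakTendsto x p ∧ WeakTendsto y q := by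
  have hM0 : ∀ u : X, 0 ≤ ⟪M u, u⟫ := fun u => (by positivity : (0 : ℝ) ≤ _).trans (hML u)
  have hW0 : ∀ v : Y, 0 ≤ ⟪W v, v⟫ := fun v => (by positivity : (0 : ℝ) ≤ _).trans (hWw v)
  have hdesc : ∀ p, IsSaddle R F A b p → ∀ k, _ := fun p hp k =>
    pdEnergy_succ_le hR hconv hF hlip hMsa hWsa hML hx hy hp k
  have hanti : ∀ p, IsSaddle R F A b p → Antitone (pdEnergy M W x y p) := fun p hp =>
    antitone_nat_of_succ_le fun k => by
      linarith [hdesc p hp k, hM0 (x (k + 1) - x k), hW0 (y (k + 1) - y k)]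
  have hE0 : ∀ p k, 0 ≤ pdEnergy M W x y p k := fun p k => add_nonneg (hM0 _) (hW0 _)
  have hconvE : ∀ p, IsSaddle R F A b p → ∃ e, Tendsto (pdEnergy M W x y p) atTop (𝓝 e) :=
    fun p hp => ⟨_, tendsto_atTop_ciInf (hanti p hp) ⟨0, by rintro _ ⟨k, rfl⟩; exact hE0 p k⟩⟩
  obtain ⟨⟨p₀, q₀⟩, hp₀⟩ := hS
  have hA₀ : A p₀ = b := ((isSaddle_iff hR).1 hp₀).1
  obtain ⟨e, he⟩ := hconvE _ hp₀
  have hdE : Tendsto (fun k => pdEnergy M W x y (p₀, q₀) k - pdEnergy M W x y (p₀, q₀) (k + 1))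
      atTop (𝓝 0) := by
    simpa using he.sub ((tendsto_add_atTop_iff_nat 1).2 he)
  have hdy : Tendsto (fun k => y (k + 1) - y k) atTop (𝓝 0) :=
    tendsto_zero_of_mul_norm_sq_le hw hdE fun k => by
      linarith [hdesc _ hp₀ k, hM0 (x (k + 1) - x k), hWw (y (k + 1) - y k)]
  have hAx1 : Tendsto (fun k => A (x (k + 1)) - b) atTop (𝓝 0) := by
    have := (W.continuous.tendsto 0).comp hdy
    simpa [Function.comp_def, hy] using this
  have hAx : Tendsto (fun k => A (x k) - b) atTop (𝓝 0) :=
    (tendsto_add_atTop_iff_nat (f := fun k => A (x k) - b) 1).1 hAx1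
  have hdx : Tendsto (fun k => x (k + 1) - x k) atTop (𝓝 0) := by
    have h1 : Tendsto (fun k => A (x (k + 1) - x k)) atTop (𝓝 0) := by
      simpa using hAx1.sub hAx
    have h2 : Tendsto (fun k => 2 * (pdEnergy M W x y (p₀, q₀) k
        - pdEnergy M W x y (p₀, q₀) (k + 1)) + s * ‖A (x (k + 1) - x k)‖ ^ 2) atTop (𝓝 0) := by
      simpa using (hdE.const_mul 2).add ((h1.norm.pow 2).const_mul s)
    exact tendsto_zero_of_mul_norm_sq_le hc h2 fun k => by
      linarith [hdesc _ hp₀ k, hMA (x (k + 1) - x k), hW0 (y (k + 1) - y k)]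
  obtain ⟨D, hD⟩ : ∃ D, ∀ k, ‖y k‖ ≤ D := by
    refine ⟨√(w⁻¹ * pdEnergy M W x y (p₀, q₀) 0) + ‖q₀‖, fun k => ?_⟩
    have h1 : ‖y k - q₀‖ ≤ √(w⁻¹ * pdEnergy M W x y (p₀, q₀) 0) := by
      refine Real.le_sqrt_of_sq_le ?_
      rw [inv_mul_eq_div, le_div_iff₀ hw]
      have h2 := hanti _ hp₀ (Nat.zero_le k)
      have h3 : pdEnergy M W x y (p₀, q₀) k =
        ⟪M (x k - p₀), x k - p₀⟫ + ⟪W (y k - q₀), y k - q₀⟫ := rfl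
      linarith [hWw (y k - q₀), hM0 (x k - p₀)]
    linarith [norm_le_norm_add_norm_sub' (y k) q₀]
  obtain ⟨C, hC⟩ : ∃ C, ∀ k, ‖x k‖ ≤ C := by
    obtain ⟨B, hB⟩ := ((hAx.norm.pow 2).const_mul s).bddAbove_range
    refine ⟨√(c⁻¹ * (pdEnergy M W x y (p₀, q₀) 0 + B)) + ‖p₀‖, fun k => ?_⟩
    have h1 : ‖x k - p₀‖ ≤ √(c⁻¹ * (pdEnergy M W x y (p₀, q₀) 0 + B)) := by
      refine Real.le_sqrt_of_sq_le ?_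
      rw [inv_mul_eq_div, le_div_iff₀ hc]
      have h2 := hanti _ hp₀ (Nat.zero_le k)
      have h3 : pdEnergy M W x y (p₀, q₀) k =
        ⟪M (x k - p₀), x k - p₀⟫ + ⟪W (y k - q₀), y k - q₀⟫ := rfl
      have h4 : s * ‖A (x k) - b‖ ^ 2 ≤ B := hB ⟨k, rfl⟩
      have h5 := hMA (x k - p₀)
      rw [map_sub A, hA₀] at h5
      linarith [hW0 (y k - q₀)]
    linarith [norm_le_norm_add_norm_sub' (x k) p₀]
  have hlimit : ∀ U : Ultrafilter ℕ, (U : Filter ℕ) ≤ atTop → ∃ p q, IsSaddle R F A b (p, q) ∧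
      WeakTendstoAlong (U : Filter ℕ) x p ∧ WeakTendstoAlong (U : Filter ℕ) y q := by
    intro U hU
    obtain ⟨p, hp⟩ := exists_weakTendstoAlong U hC
    obtain ⟨q, hq⟩ := exists_weakTendstoAlong U hD
    exact ⟨p, q, isSaddle_of_weakTendstoAlong hR hconv hF hlip hL hx hC hD (hdx.mono_left hU)
      (hdy.mono_left hU) (hAx1.mono_left hU) hp hq, hp, hq⟩
  obtain ⟨p, q, hpq, hp, hq⟩ := hlimit (Ultrafilter.of atTop) (Ultrafilter.of_le _)
  have huniq : ∀ U : Ultrafilter ℕ, (U : Filter ℕ) ≤ atTop →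
      WeakTendstoAlong (U : Filter ℕ) x p ∧ WeakTendstoAlong (U : Filter ℕ) y q := by
    intro U hU
    obtain ⟨p', q', hpq', hp', hq'⟩ := hlimit U hU
    obtain ⟨e₁, he₁⟩ := hconvE _ hpq
    obtain ⟨e₂, he₂⟩ := hconvE _ hpq'
    have hdiff : Tendsto (fun k => ⟪x k, M (p - p')⟫ + ⟪y k, W (q - q')⟫) atTop
        (𝓝 (1 / 2 * (⟪M p, p⟫ - ⟪M p', p'⟫ + (⟪W q, q⟫ - ⟪W q', q'⟫) - (e₁ - e₂)))) := by
      refine (((he₁.sub he₂).const_sub _).const_mul (1 / 2)).congr fun k => ?_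
      have h1 := inner_sub_sub_inner_sub_eq hMsa (x k) p p'
      have h2 := inner_sub_sub_inner_sub_eq hWsa (y k) q q'
      simp only [pdEnergy]
      linarith
    have h1 := tendsto_nhds_unique ((hp _).add (hq _)) (hdiff.mono_left (Ultrafilter.of_le _))
    have h2 := tendsto_nhds_unique ((hp' _).add (hq' _)) (hdiff.mono_left hU)
    have h3 : ⟪M (p - p'), p - p'⟫ + ⟪W (q - q'), q - q'⟫ = 0 := by
      rw [real_inner_comm, real_inner_comm (q - q'), inner_sub_left, inner_sub_left]
      linarith
    have hA : A (p - p') = 0 := by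
      rw [map_sub, ((isSaddle_iff hR).1 hpq).1, ((isSaddle_iff hR).1 hpq').1, sub_self]
    have h4 := hMA (p - p')
    rw [hA, norm_zero] at h4
    have h5 : p - p' = 0 := by
      have : ‖p - p'‖ ^ 2 ≤ 0 := by
        refine le_of_mul_le_mul_left ?_ hc
        linarith [hW0 (q - q')]
      simpa using le_antisymm this (sq_nonneg _)
    have h6 : q - q' = 0 := by
      have : ‖q - q'‖ ^ 2 ≤ 0 := by
        refine le_of_mul_le_mul_left ?_ hw
        linarith [hM0 (p - p'), hWw (q - q')]
      simpa using le_antisymm this (sq_nonneg _)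
    rw [sub_eq_zero.1 h5, sub_eq_zero.1 h6]
    exact ⟨hp', hq'⟩
  exact ⟨p, q, hpq, fun v => tendsto_iff_ultrafilter _ _ _ |>.2 fun U hU => (huniq U hU).1 v,
    fun v => tendsto_iff_ultrafilter _ _ _ |>.2 fun U hU => (huniq U hU).2 v⟩

end ForwardBackward

/-- With exact data and exact proximal steps, if the exact Lagrangian has a
saddle point and `ω = 1 - τ_M (L + σ_M ‖A‖²) ≥ 0`, the primal–dual iterates converge weakly to
a saddle point; in particular the primal iterates converge weakly to a minimizer of `R + F`
over `{x : A x = b*}`. -/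
theorem statement_0
    (A : X →L[ℝ] Y) (bstar : Y)
    (R : X → EReal) (hR : ProperConvexLsc R)
    (F : X → ℝ) (F' : X → X) (L : ℝ) (hL : 0 ≤ L)
    (hFconv : ConvexOn ℝ Set.univ F)
    (hFgrad : ∀ u : X, HasGradientAt F (F' u) u)
    (hFlip : ∀ u v : X, ‖F' u - F' v‖ ≤ L * ‖u - v‖)
    (T Tinv : X →L[ℝ] X) (Sg Sginv : Y →L[ℝ] Y)
    (hTinv : ∀ u, Tinv (T u) = u) (hTinv' : ∀ u, T (Tinv u) = u)
    (hSginv : ∀ v, Sginv (Sg v) = v) (hSginv' : ∀ v, Sg (Sginv v) = v)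
    (hTsa : ∀ u v : X, ⟪T u, v⟫ = ⟪u, T v⟫)
    (hSgsa : ∀ u v : Y, ⟪Sg u, v⟫ = ⟪u, Sg v⟫)
    (τm τM σm σM : ℝ) (hτm : 0 < τm) (hττ : τm ≤ τM) (hσm : 0 < σm) (hσσ : σm ≤ σM)
    (hTb : ∀ u : X, τm * ‖u‖ ^ 2 ≤ ⟪T u, u⟫ ∧ ⟪T u, u⟫ ≤ τM * ‖u‖ ^ 2)
    (hSgb : ∀ v : Y, σm * ‖v‖ ^ 2 ≤ ⟪Sg v, v⟫ ∧ ⟪Sg v, v⟫ ≤ σM * ‖v‖ ^ 2)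
    (hω : 0 ≤ 1 - τM * (L + σM * ‖A‖ ^ 2))
    (hSaddle : ∃ p : X × Y, IsSaddle R F A bstar p)
    (x : ℕ → X) (y : ℕ → Y) (ym1 : Y)
    (hstep : ∀ k : ℕ,
      -(Tinv (x (k + 1) - x k)) - F' (x k)
          - ContinuousLinearMap.adjoint A ((2 : ℝ) • y k - (if k = 0 then ym1 else y (k - 1)))
        ∈ epsSubdiff R 0 (x (k + 1)))
    (hdual : ∀ k : ℕ, y (k + 1) = y k + Sg (A (x (k + 1)) - bstar)) :
    ∃ xi : X, ∃ yi : Y, IsSaddle R F A bstar (xi, yi) ∧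
      WeakTendsto x xi ∧ WeakTendsto y yi ∧
      A xi = bstar ∧
      ∀ u : X, A u = bstar → R xi + (F xi : EReal) ≤ R u + (F u : EReal) := by
  have hτ : 0 < τM := hτm.trans_le hττ
  have hσ : 0 < σM := hσm.trans_le hσσ
  have hT := inner_inverse_ge hTinv' hTsa hτ
    (fun u => (by positivity : (0 : ℝ) ≤ _).trans (hTb u).1) (fun u => (hTb u).2)
  have hS := inner_inverse_ge hSginv' hSgsa hσ
    (fun v => (by positivity : (0 : ℝ) ≤ _).trans (hSgb v).1) (fun v => (hSgb v).2)
  let M : X →L[ℝ] X := Tinv - (ContinuousLinearMap.adjoint A ∘L Sg ∘L A)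
  have hMapply : ∀ u, M u = Tinv u - ContinuousLinearMap.adjoint A (Sg (A u)) := fun u => rfl
  have hMinner : ∀ u v, ⟪M u, v⟫ = ⟪Tinv u, v⟫ - ⟪Sg (A u), A v⟫ := fun u v => by
    rw [hMapply, inner_sub_left, ContinuousLinearMap.adjoint_inner_left]
  have hMsa : ∀ u v, ⟪M u, v⟫ = ⟪u, M v⟫ := fun u v => by
    rw [real_inner_comm (M v) u, hMinner, hMinner, inverse_symmetric hTinv' hTsa, hSgsa,
      real_inner_comm u, real_inner_comm (A u)]
  have hML : ∀ u, L * ‖u‖ ^ 2 ≤ ⟪M u, u⟫ := by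
    intro u
    have h1 : ‖A u‖ ^ 2 ≤ ‖A‖ ^ 2 * ‖u‖ ^ 2 := by
      rw [← mul_pow]
      exact pow_le_pow_left₀ (norm_nonneg _) (A.le_opNorm u) 2
    have h2 : L + σM * ‖A‖ ^ 2 ≤ τM⁻¹ := by
      rw [← one_div, le_div_iff₀' hτ]
      linarith
    have h3 := mul_le_mul_of_nonneg_right h2 (sq_nonneg ‖u‖)
    have h4 := mul_le_mul_of_nonneg_left h1 hσ.le
    rw [hMinner]
    linarith [hT u, (hSgb (A u)).2]
  have hMA : ∀ u, τM⁻¹ * ‖u‖ ^ 2 ≤ ⟪M u, u⟫ + σM * ‖A u‖ ^ 2 := by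
    intro u
    rw [hMinner]
    linarith [hT u, (hSgb (A u)).2]
  have hy : ∀ k, Sginv (y (k + 1) - y k) = A (x (k + 1)) - bstar := fun k => by
    rw [hdual k, add_sub_cancel_left, hSginv]
  have hx : ∀ k, -M (x (k + 1 + 1) - x (k + 1)) - F' (x (k + 1))
      - ContinuousLinearMap.adjoint A (y (k + 1 + 1)) ∈ epsSubdiff R 0 (x (k + 1 + 1)) := by
    intro k
    have h := hstep (k + 1)
    rw [if_neg (Nat.succ_ne_zero k), Nat.add_sub_cancel] at h
    convert h using 1
    have e : (2 : ℝ) • y (k + 1) - y k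
        = y (k + 1 + 1) - Sg (A (x (k + 1 + 1) - x (k + 1))) := by
      rw [hdual (k + 1), hdual k]
      simp only [map_sub]
      module
    rw [e, hMapply, map_sub (ContinuousLinearMap.adjoint A)]
    abel
  obtain ⟨p, q, hpq, hp, hq⟩ := exists_isSaddle_weakTendsto (x := fun k => x (k + 1))
    (y := fun k => y (k + 1)) hR hFconv hFgrad hFlip hL hMsa
    (inverse_symmetric hSginv' hSgsa) hML (inv_pos.2 hτ) (inv_pos.2 hσ) hMA hS hx
    (fun k => hy (k + 1)) hSaddle
  obtain ⟨hA, hmin⟩ := (isSaddle_iff hR).1 hpq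
  refine ⟨p, q, hpq, fun w => (tendsto_add_atTop_iff_nat 1).1 (hp w),
    fun w => (tendsto_add_atTop_iff_nat 1).1 (hq w), hA, fun u hu => ?_⟩
  simpa [hu] using hmin u
end
end

section
/- Let (x*, y*) ∈ S* be a saddle point of the exact Lagrangian, and let (x, y) ∈ X × Y satisfy L_{b*}(x, y*) − L_{b*}(x*, y) = 0 and Ax = b*. Then (x, y*) is also a saddle point of the exact Lagrangian, i.e. (x, y*) ∈ S*. -/
open scoped RealInnerProductSpace ENNReal NNReal
open Filter Topology

noncomputable section

variable {X Y : Type*}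
  [NormedAddCommGroup X] [InnerProductSpace ℝ X] [CompleteSpace X]
  [NormedAddCommGroup Y] [InnerProductSpace ℝ Y] [CompleteSpace Y]

theorem EReal.eq_of_sub_eq_zero {a b : EReal} (h : a - b = 0) : a = b := by
  induction a <;> induction b <;> simp_all
  norm_cast at h ⊢
  exact sub_eq_zero.mp h

/-- If `(x*, y*)` is a saddle point of the exact Lagrangian, `(x, y)` has zero
Lagrangian gap `L_{b*}(x, y*) - L_{b*}(x*, y) = 0` and is feasible (`A x = b*`), then `(x, y*)`
is also a saddle point. -/
theorem statement_1
    (A : X →L[ℝ] Y) (bstar : Y)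
    (R : X → EReal) (hR : ProperConvexLsc R)
    (F : X → ℝ) (F' : X → X) (L : ℝ) (hL : 0 ≤ L)
    (hFconv : ConvexOn ℝ Set.univ F)
    (hFgrad : ∀ u : X, HasGradientAt F (F' u) u)
    (hFlip : ∀ u v : X, ‖F' u - F' v‖ ≤ L * ‖u - v‖)
    (xstar : X) (ystar : Y) (hsaddle : IsSaddle R F A bstar (xstar, ystar))
    (x : X) (y : Y)
    (hgap : Lag R F A bstar x ystar - Lag R F A bstar xstar y = 0)
    (hfeas : A x = bstar) :
    IsSaddle R F A bstar (x, ystar) := by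
  intro x' y'
  have hLag : Lag R F A bstar x y' = Lag R F A bstar x ystar := by
    simp [Lag, hfeas]
  rw [hLag, EReal.eq_of_sub_eq_zero hgap]
  exact hsaddle x' y
end
end

section
/- Assume the initialization y₀ = y₋₁ + Σ(Ax₀ − b^δ), let (x*, y*) ∈ S*, let 0 ≤ δ ≤ 1 and assume ‖b^δ − b*‖ ≤ δ, 0 ≤ ε_k ≤ C₀δ for every k (with C₀ ≥ 0 fixed), ω := 1 − τ_M(L + σ_M‖A‖²) ≥ 0, and that there exist ξ ∈ (0,1) and η > 1 with θ := ξ − τ_M(ξL + σ_M‖A‖²) ≥ 0 and ρ := σ_m(η−1) − σ_Mξη > 0. Then there exist constants C₅, C₆, C₇, C₈, C₉ ≥ 0, independent of k and of δ, such that for every k ≥ 1: ‖Ax̂_k − b*‖² ≤ C₅/k + C₆δ + C₇δ^{3/2}√k + C₈δ²k + C₉δ². -/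
open scoped RealInnerProductSpace ENNReal NNReal
open Filter Topology

noncomputable section

variable {X Y : Type*}
  [NormedAddCommGroup X] [InnerProductSpace ℝ X] [CompleteSpace X]
  [NormedAddCommGroup Y] [InnerProductSpace ℝ Y] [CompleteSpace Y]

/-- First-order lower bound for a differentiable convex function. -/
theorem ConvexOn.add_inner_gradient_le {E : Type*} [NormedAddCommGroup E] [InnerProductSpace ℝ E]
    [CompleteSpace E] {f : E → ℝ} {g u : E} (hf : ConvexOn ℝ Set.univ f)
    (hg : HasGradientAt f g u) (v : E) : f u + ⟪g, v - u⟫ ≤ f v := by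
  have hconv : ConvexOn ℝ Set.univ (fun t : ℝ => f (AffineMap.lineMap u v t)) :=
    hf.comp_affineMap (AffineMap.lineMap u v)
  have hderiv : HasDerivAt (fun t : ℝ => f (AffineMap.lineMap u v t)) ⟪g, v - u⟫ 0 := by
    have hf' : HasFDerivAt f (InnerProductSpace.toDual ℝ E g)
        (AffineMap.lineMap u v (0 : ℝ)) := by
      simpa using hg.hasFDerivAt
    simpa [Function.comp_def] using hf'.comp_hasDerivAt (0 : ℝ) AffineMap.hasDerivAt_lineMap
  have h := hconv.le_slope_of_hasDerivAt (Set.mem_univ 0) (Set.mem_univ 1) one_pos hderiv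
  simp only [slope_def_field, AffineMap.lineMap_apply_one, AffineMap.lineMap_apply_zero] at h
  linarith

/-- The descent lemma: quadratic upper bound for a function with Lipschitz gradient. -/
theorem le_add_inner_gradient_add_sq_of_lipschitz {E : Type*} [NormedAddCommGroup E]
    [InnerProductSpace ℝ E] [CompleteSpace E] {f : E → ℝ} {f' : E → E} {L : ℝ}
    (hf : ∀ u, HasGradientAt f (f' u) u) (hL : ∀ u v, ‖f' u - f' v‖ ≤ L * ‖u - v‖) (u v : E) :
    f v ≤ f u + ⟪f' u, v - u⟫ + L / 2 * ‖v - u‖ ^ 2 := by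
  set d := v - u with hd
  have hderiv (t : ℝ) : HasDerivAt
      (fun t : ℝ => f (AffineMap.lineMap u v t) - (t * ⟪f' u, d⟫ + L / 2 * ‖d‖ ^ 2 * t ^ 2))
      (⟪f' (AffineMap.lineMap u v t), d⟫ - (⟪f' u, d⟫ + L * ‖d‖ ^ 2 * t)) t := by
    have h₁ : HasDerivAt (fun t : ℝ => f (AffineMap.lineMap u v t))
        ⟪f' (AffineMap.lineMap u v t), d⟫ t := by
      simpa [Function.comp_def] using (hf _).hasFDerivAt.comp_hasDerivAt t AffineMap.hasDerivAt_lineMap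
    have h₂ : HasDerivAt (fun t : ℝ => t * ⟪f' u, d⟫ + L / 2 * ‖d‖ ^ 2 * t ^ 2)
        (⟪f' u, d⟫ + L * ‖d‖ ^ 2 * t) t := by
      refine (((hasDerivAt_id t).mul_const ⟪f' u, d⟫).add
        ((hasDerivAt_pow 2 t).const_mul (L / 2 * ‖d‖ ^ 2))).congr_deriv ?_
      push_cast
      ring
    exact h₁.sub h₂
  have hanti := antitoneOn_of_deriv_nonpos (convex_Icc (0 : ℝ) 1)
    (fun t _ => (hderiv t).continuousAt.continuousWithinAt)
    (fun t _ => (hderiv t).differentiableAt.differentiableWithinAt) (fun t ht => by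
      rw [interior_Icc] at ht
      rw [(hderiv t).deriv]
      have hdist : ‖f' (AffineMap.lineMap u v t) - f' u‖ ≤ L * (t * ‖d‖) := by
        refine (hL _ _).trans_eq ?_
        rw [AffineMap.lineMap_apply, vsub_eq_sub, vadd_eq_add, add_sub_cancel_right, norm_smul,
          Real.norm_of_nonneg ht.1.le]
      have hinner := real_inner_le_norm (f' (AffineMap.lineMap u v t) - f' u) d
      rw [inner_sub_left] at hinner
      nlinarith [mul_le_mul_of_nonneg_right hdist (norm_nonneg d)])
  have h := hanti (Set.left_mem_Icc.2 zero_le_one) (Set.right_mem_Icc.2 zero_le_one) zero_le_one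
  simp only [AffineMap.lineMap_apply_one, AffineMap.lineMap_apply_zero] at h
  linarith

/-- A symmetric operator bounded above by `M` has an inverse bounded below by `M⁻¹`. -/
theorem norm_sq_le_mul_inner_of_inverse {E : Type*} [NormedAddCommGroup E] [InnerProductSpace ℝ E]
    {S Sinv : E →L[ℝ] E} {M : ℝ} (hinv : ∀ v, S (Sinv v) = v)
    (hsymm : ∀ u v, ⟪S u, v⟫ = ⟪u, S v⟫) (hM : 0 < M) (hpos : ∀ v, 0 ≤ ⟪S v, v⟫)
    (hle : ∀ v, ⟪S v, v⟫ ≤ M * ‖v‖ ^ 2) (v : E) : ‖v‖ ^ 2 ≤ M * ⟪Sinv v, v⟫ := by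
  have h := hpos (M • Sinv v - v)
  have hswap : ⟪S v, Sinv v⟫ = ‖v‖ ^ 2 := by
    rw [hsymm, hinv, real_inner_self_eq_norm_sq]
  rw [map_sub, map_smul, hinv, inner_sub_left, inner_sub_right, inner_sub_right, inner_smul_left,
    inner_smul_left, inner_smul_right, inner_smul_right, hswap, real_inner_self_eq_norm_sq] at h
  simp only [conj_trivial] at h
  have hM' : M * ‖v‖ ^ 2 ≤ M * (M * ⟪Sinv v, v⟫) := by
    rw [real_inner_comm v (Sinv v)] at *
    linarith [hle v]
  exact le_of_mul_le_mul_left hM' hM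

theorem IsSaddle.apply_ne_top
    {X Y : Type*} [NormedAddCommGroup X] [InnerProductSpace ℝ X]
    [NormedAddCommGroup Y] [InnerProductSpace ℝ Y]
    {R : X → EReal} (hR : ProperConvexLsc R) {F : X → ℝ}
    {A : X →L[ℝ] Y} {b : Y} {xs : X} {ys : Y} (h : IsSaddle R F A b (xs, ys)) : R xs ≠ ⊤ := by
  obtain ⟨x, hx⟩ := hR.1
  intro htop
  have hle := h x ys
  simp only [Lag, htop, EReal.top_add_coe, top_le_iff] at hle
  exact EReal.add_ne_top hx (EReal.coe_ne_top _) hle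

theorem IsSaddle.map_eq
    {X Y : Type*} [NormedAddCommGroup X] [InnerProductSpace ℝ X]
    [NormedAddCommGroup Y] [InnerProductSpace ℝ Y]
    {R : X → EReal} (hR : ProperConvexLsc R) {F : X → ℝ}
    {A : X →L[ℝ] Y} {b : Y} {xs : X} {ys : Y} (h : IsSaddle R F A b (xs, ys)) : A xs = b := by
  have hle := h xs (ys + (A xs - b))
  simp only [Lag] at hle
  lift R xs to ℝ using ⟨h.apply_ne_top hR, hR.2.1 xs⟩ with ρ
  norm_cast at hle
  rw [inner_add_left, real_inner_self_eq_norm_sq] at hle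
  have hsq : ‖A xs - b‖ ^ 2 = 0 := le_antisymm (by linarith) (sq_nonneg _)
  simpa [sub_eq_zero] using hsq

/-- Variational inequality satisfied by an inexact forward–backward step. -/
theorem IsSaddle.forward_backward_step {R : X → EReal} (hR : ProperConvexLsc R) {F : X → ℝ}
    {F' : X → X} {L : ℝ} (hFconv : ConvexOn ℝ Set.univ F)
    (hFgrad : ∀ u : X, HasGradientAt F (F' u) u)
    (hFlip : ∀ u v : X, ‖F' u - F' v‖ ≤ L * ‖u - v‖)
    {A : X →L[ℝ] Y} {b : Y} {xs : X} {ys : Y} (h : IsSaddle R F A b (xs, ys))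
    {ε : ℝ} {x x' w : X} {z : Y}
    (hstep : -w - F' x - ContinuousLinearMap.adjoint A z ∈ epsSubdiff R ε x') :
    0 ≤ -⟪w, x' - xs⟫ - ⟪z - ys, A (x' - xs)⟫ + ε + L / 2 * ‖x' - x‖ ^ 2 := by
  have hsub := hstep xs
  have hsad := h x' ys
  have hA := h.map_eq hR
  have hx' : R x' ≠ ⊤ := by
    intro htop
    rw [htop, EReal.top_add_coe, top_le_iff] at hsub
    exact h.apply_ne_top hR hsub
  simp only [Lag, hA, sub_self, inner_zero_right, add_zero] at hsad
  lift R xs to ℝ using ⟨h.apply_ne_top hR, hR.2.1 xs⟩ with Rs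
  lift R x' to ℝ using ⟨hx', hR.2.1 x'⟩ with R'
  norm_cast at hsub hsad
  have hup := le_add_inner_gradient_add_sq_of_lipschitz hFgrad hFlip x x'
  have hlow := hFconv.add_inner_gradient_le (hFgrad x) xs
  have hadj : ⟪ContinuousLinearMap.adjoint A z, xs - x'⟫ = ⟪z, A (xs - x')⟫ :=
    ContinuousLinearMap.adjoint_inner_left A _ _
  rw [inner_sub_left, inner_sub_left, inner_neg_left, hadj] at hsub
  simp only [map_sub, inner_sub_right, inner_sub_left, hA] at *
  linarith

/-- One-step energy estimate for the inexact, noisy primal–dual iteration. -/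
theorem Vfun_step_le
    {X Y : Type*} [NormedAddCommGroup X] [InnerProductSpace ℝ X]
    [NormedAddCommGroup Y] [InnerProductSpace ℝ Y]
    {A : X →L[ℝ] Y} {bs b : Y} {Tinv : X →L[ℝ] X} {Sg Sginv : Y →L[ℝ] Y}
    {L τM σM ε : ℝ} (hTsymm : ∀ u v : X, ⟪Tinv u, v⟫ = ⟪u, Tinv v⟫)
    (hSginv : ∀ v, Sginv (Sg v) = v) (hSginv' : ∀ v, Sg (Sginv v) = v)
    (hSgsa : ∀ u v : Y, ⟪Sg u, v⟫ = ⟪u, Sg v⟫) (hSgpos : ∀ v, 0 ≤ ⟪Sg v, v⟫)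
    (hσM : 0 ≤ σM) (hSgle : ∀ v, ⟪Sg v, v⟫ ≤ σM * ‖v‖ ^ 2)
    (hτM : 0 < τM) (hTinvle : ∀ d, ‖d‖ ^ 2 ≤ τM * ⟪Tinv d, d⟫)
    (hω : 0 ≤ 1 - τM * (L + σM * ‖A‖ ^ 2)) {xs x x' : X} {ys y : Y} (hxs : A xs = bs)
    (hstep : 0 ≤ -⟪Tinv (x' - x), x' - xs⟫ - ⟪y + Sg (A x - b) - ys, A (x' - xs)⟫ + ε
      + L / 2 * ‖x' - x‖ ^ 2) :
    Vfun Tinv Sginv (x' - xs, y + Sg (A x' - b) - ys)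
      ≤ Vfun Tinv Sginv (x - xs, y - ys) + ε + σM / 2 * ‖b - bs‖ ^ 2
        + ‖b - bs‖ * ‖y - ys‖ := by
  obtain ⟨p, hp⟩ : ∃ p, p = x - xs := ⟨_, rfl⟩
  obtain ⟨d, hd⟩ : ∃ d, d = x' - x := ⟨_, rfl⟩
  obtain ⟨q, hq⟩ : ∃ q, q = y - ys := ⟨_, rfl⟩
  obtain ⟨r, hr⟩ : ∃ r, r = A x - b := ⟨_, rfl⟩
  obtain ⟨e, he⟩ : ∃ e, e = b - bs := ⟨_, rfl⟩
  have hpd : x' - xs = p + d := by rw [hp, hd]; abel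
  have hr' : A x' - b = r + A d := by rw [hr, hd, map_sub]; abel
  have hApd : A (p + d) = r + A d + e := by rw [map_add, hp, map_sub, hxs, hr, he]; abel
  have hq₁ : y + Sg r - ys = q + Sg r := by rw [hq]; abel
  have hq₂ : y + Sg (r + A d) - ys = q + Sg (r + A d) := by rw [hq]; abel
  rw [hpd, ← hr, hq₁, ← hd, hApd] at hstep
  rw [hpd, hr', hq₂, ← hp, ← hq, ← he]
  have hAd : σM * ‖A d‖ ^ 2 ≤ σM * ‖A‖ ^ 2 * ‖d‖ ^ 2 := by
    rw [mul_assoc, ← mul_pow]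
    gcongr
    exact A.le_opNorm d
  have hquad : (L + σM * ‖A‖ ^ 2) * ‖d‖ ^ 2 ≤ ⟪Tinv d, d⟫ := by
    have h₁ := hTinvle d
    have h₂ := mul_nonneg hω (sq_nonneg ‖d‖)
    refine le_of_mul_le_mul_left ?_ hτM
    linarith
  have hnoise := hSgpos (r + e)
  have hcs : -⟪q, e⟫ ≤ ‖e‖ * ‖q‖ := by
    have := neg_le_of_abs_le (abs_real_inner_le_norm q e)
    linarith
  have hSd := hSgle (A d)
  have hSe := hSgle e
  have e₁ : ⟪Tinv p, d⟫ = ⟪Tinv d, p⟫ := by rw [hTsymm, real_inner_comm]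
  have e₂ (v : Y) : ⟪Sginv q, Sg v⟫ = ⟪q, v⟫ := by rw [← hSgsa, hSginv']
  have e₃ (v w : Y) : ⟪Sg v, w⟫ = ⟪Sg w, v⟫ := by rw [hSgsa, real_inner_comm]
  have e₄ : ⟪r, Sg r⟫ = ⟪Sg r, r⟫ := real_inner_comm _ _
  have e₅ : ⟪r, Sg (A d)⟫ = ⟪Sg r, A d⟫ := (hSgsa _ _).symm
  have e₆ : ⟪A d, Sg r⟫ = ⟪Sg r, A d⟫ := real_inner_comm _ _
  have e₇ : ⟪A d, Sg (A d)⟫ = ⟪Sg (A d), A d⟫ := real_inner_comm _ _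
  simp only [Vfun, map_add, hSginv, inner_add_left, inner_add_right, e₁, e₂, e₄, e₅, e₆, e₇,
    real_inner_comm q r, real_inner_comm q (A d), e₃ e r] at *
  linarith

/-- A discrete Gronwall-type estimate with linear growth. -/
theorem le_sq_of_le_add_mul {V : ℕ → ℝ} {B D δ c d : ℝ} (hB : 1 ≤ B) (hδ : 0 ≤ δ) (hc : 0 ≤ c)
    (hd : 0 ≤ d) (hD : c + d ≤ D) (h0 : V 0 ≤ B ^ 2)
    (hV : ∀ k, ∀ a, 0 ≤ a → V k ≤ a ^ 2 → V (k + 1) ≤ a ^ 2 + c * δ + d * δ * a) (k : ℕ) :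
    V k ≤ (B + D * δ * k) ^ 2 := by
  have hD0 : 0 ≤ D := by linarith
  induction k with
  | zero => simpa using h0
  | succ k ih =>
    have ha : 1 ≤ B + D * δ * k := le_add_of_le_of_nonneg hB (by positivity)
    have h := hV k _ (by linarith) ih
    push_cast
    have h₁ : c * δ ≤ c * δ * (B + D * δ * k) := le_mul_of_one_le_right (by positivity) ha
    have h₂ : (c + d) * (δ * (B + D * δ * k)) ≤ D * (δ * (B + D * δ * k)) := by gcongr
    have h₃ : 0 ≤ D * (δ * (B + D * δ * k)) := by positivity
    nlinarith [sq_nonneg (D * δ)]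

/-- The residual of the averaged iterates in terms of the dual increment. -/
theorem map_average_sub_eq
    {X Y : Type*} [NormedAddCommGroup X] [InnerProductSpace ℝ X]
    [NormedAddCommGroup Y] [InnerProductSpace ℝ Y]
    {A : X →L[ℝ] Y} {b : Y} {Sg Sginv : Y →L[ℝ] Y}
    (hSginv : ∀ v, Sginv (Sg v) = v) {x : ℕ → X} {y : ℕ → Y}
    (hy : ∀ k, y (k + 1) = y k + Sg (A (x (k + 1)) - b)) {k : ℕ} (hk : 1 ≤ k) :
    A ((k : ℝ)⁻¹ • ∑ j ∈ Finset.Icc 1 k, x j) - b = (k : ℝ)⁻¹ • Sginv (y k - y 0) := by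
  have hsum (n : ℕ) : A (∑ j ∈ Finset.Icc 1 n, x j) - (n : ℝ) • b = Sginv (y n - y 0) := by
    induction n with
    | zero => simp
    | succ n ih =>
      rw [Finset.sum_Icc_succ_top (by omega), hy, add_sub_right_comm, map_add Sginv, hSginv, ← ih,
        map_add, Nat.cast_succ, add_smul, one_smul]
      abel
  have hk0 : (k : ℝ) ≠ 0 := by positivity
  rw [← hsum, smul_sub, map_smul, smul_smul, inv_mul_cancel₀ hk0, one_smul]


/-- Stability bound on the feasibility of the averaged iterates: there are
constants `C₅, …, C₉ ≥ 0`, independent of `k` and of `δ`, such that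
`‖A x̂_k - b*‖² ≤ C₅/k + C₆ δ + C₇ δ^{3/2} √k + C₈ δ² k + C₉ δ²`. -/
theorem statement_3
    (A : X →L[ℝ] Y) (bstar : Y)
    (R : X → EReal) (hR : ProperConvexLsc R)
    (F : X → ℝ) (F' : X → X) (L : ℝ) (hL : 0 ≤ L)
    (hFconv : ConvexOn ℝ Set.univ F)
    (hFgrad : ∀ u : X, HasGradientAt F (F' u) u)
    (hFlip : ∀ u v : X, ‖F' u - F' v‖ ≤ L * ‖u - v‖)
    (T Tinv : X →L[ℝ] X) (Sg Sginv : Y →L[ℝ] Y)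
    (hTinv : ∀ u, Tinv (T u) = u) (hTinv' : ∀ u, T (Tinv u) = u)
    (hSginv : ∀ v, Sginv (Sg v) = v) (hSginv' : ∀ v, Sg (Sginv v) = v)
    (hTsa : ∀ u v : X, ⟪T u, v⟫ = ⟪u, T v⟫)
    (hSgsa : ∀ u v : Y, ⟪Sg u, v⟫ = ⟪u, Sg v⟫)
    (τm τM σm σM : ℝ) (hτm : 0 < τm) (hττ : τm ≤ τM) (hσm : 0 < σm) (hσσ : σm ≤ σM)
    (hTb : ∀ u : X, τm * ‖u‖ ^ 2 ≤ ⟪T u, u⟫ ∧ ⟪T u, u⟫ ≤ τM * ‖u‖ ^ 2)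
    (hSgb : ∀ v : Y, σm * ‖v‖ ^ 2 ≤ ⟪Sg v, v⟫ ∧ ⟪Sg v, v⟫ ≤ σM * ‖v‖ ^ 2)
    (hω : 0 ≤ 1 - τM * (L + σM * ‖A‖ ^ 2))
    (ξ η : ℝ) (hξ0 : 0 < ξ) (hξ1 : ξ < 1) (hη : 1 < η)
    (hθ : 0 ≤ ξ - τM * (ξ * L + σM * ‖A‖ ^ 2))
    (hρ : 0 < σm * (η - 1) - σM * ξ * η)
    (xstar : X) (ystar : Y) (hsaddle : IsSaddle R F A bstar (xstar, ystar))
    (C₀ : ℝ) (hC₀ : 0 ≤ C₀)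
    (x₀ : X) (ym1 : Y) :
    ∃ C₅ C₆ C₇ C₈ C₉ : ℝ, 0 ≤ C₅ ∧ 0 ≤ C₆ ∧ 0 ≤ C₇ ∧ 0 ≤ C₈ ∧ 0 ≤ C₉ ∧
      ∀ δ : ℝ, 0 ≤ δ → δ ≤ 1 →
      ∀ bδ : Y, ‖bδ - bstar‖ ≤ δ →
      ∀ ε : ℕ → ℝ, (∀ k, 0 ≤ ε k ∧ ε k ≤ C₀ * δ) →
      ∀ x : ℕ → X, ∀ y : ℕ → Y,
        x 0 = x₀ →
        y 0 = ym1 + Sg (A x₀ - bδ) →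
        (∀ k : ℕ,
          -(Tinv (x (k + 1) - x k)) - F' (x k)
              - ContinuousLinearMap.adjoint A
                  ((2 : ℝ) • y k - (if k = 0 then ym1 else y (k - 1)))
            ∈ epsSubdiff R (ε (k + 1)) (x (k + 1))) →
        (∀ k : ℕ, y (k + 1) = y k + Sg (A (x (k + 1)) - bδ)) →
        ∀ k : ℕ, 1 ≤ k →
          ‖A ((k : ℝ)⁻¹ • ∑ j ∈ Finset.Icc 1 k, x j) - bstar‖ ^ 2
            ≤ C₅ / k + C₆ * δ + C₇ * δ ^ ((3 : ℝ) / 2) * Real.sqrt k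
              + C₈ * δ ^ 2 * k + C₉ * δ ^ 2 := by
  have hτM : 0 < τM := hτm.trans_le hττ
  have hσM : 0 < σM := hσm.trans_le hσσ
  have hA := hsaddle.map_eq hR
  have hTpos (u : X) : 0 ≤ ⟪T u, u⟫ := le_trans (by positivity) (hTb u).1
  have hSgpos (v : Y) : 0 ≤ ⟪Sg v, v⟫ := le_trans (by positivity) (hSgb v).1
  have hTinvle := norm_sq_le_mul_inner_of_inverse hTinv' hTsa hτM hTpos fun u => (hTb u).2
  have hSginvle := norm_sq_le_mul_inner_of_inverse hSginv' hSgsa hσM hSgpos fun v => (hSgb v).2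
  have hTsymm (u v : X) : ⟪Tinv u, v⟫ = ⟪u, Tinv v⟫ := by
    rw [← hTinv' v, hTinv, ← hTsa, hTinv']
  have hnorm {p : X} {q : Y} {a : ℝ} (ha : 0 ≤ a) (h : Vfun Tinv Sginv (p, q) ≤ a ^ 2) :
      ‖q‖ ≤ √(2 * σM) * a := by
    have hp : 0 ≤ ⟪Tinv p, p⟫ :=
      nonneg_of_mul_nonneg_right ((sq_nonneg _).trans (hTinvle p)) hτM
    simp only [Vfun] at h
    refine abs_le_of_sq_le_sq' ?_ (by positivity) |>.2
    rw [mul_pow, Real.sq_sqrt (by positivity)]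
    nlinarith [hSginvle q]
  set q₀ : ℝ := ‖ym1 + Sg (A x₀ - bstar) - ystar‖ + ‖Sg‖
  set B : ℝ := 1 + |⟪Tinv (x₀ - xstar), x₀ - xstar⟫| + ‖Sginv‖ * q₀ ^ 2
  set s : ℝ := √(2 * σM)
  set c : ℝ := C₀ + σM / 2
  set P : ℝ := ‖Sginv‖ * (2 * s * B)
  set Q : ℝ := ‖Sginv‖ * (s * (c + s)) + 1
  have hB : 1 ≤ B := by
    have : 0 ≤ ‖Sginv‖ * q₀ ^ 2 := by positivity
    have := abs_nonneg ⟪Tinv (x₀ - xstar), x₀ - xstar⟫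
    simp only [B]
    linarith
  refine ⟨2 * P ^ 2, 0, 0, 0, 2 * Q ^ 2, by positivity, le_rfl, le_rfl, le_rfl, by positivity, ?_⟩
  intro δ hδ hδ1 bδ hbδ ε hε x y hx0 hy0 hx hy k hk
  have hV0 : Vfun Tinv Sginv (x 0 - xstar, y 0 - ystar) ≤ B ^ 2 := by
    have hq : ‖y 0 - ystar‖ ≤ q₀ := by
      have : y 0 - ystar = (ym1 + Sg (A x₀ - bstar) - ystar) - Sg (bδ - bstar) := by
        rw [hy0]
        simp only [map_sub]
        abel
      rw [this]
      refine (norm_sub_le _ _).trans (add_le_add_right ?_ _)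
      exact (Sg.le_opNorm _).trans (mul_le_of_le_one_right (norm_nonneg _) (hbδ.trans hδ1))
    have hS : ⟪Sginv (y 0 - ystar), y 0 - ystar⟫ ≤ ‖Sginv‖ * q₀ ^ 2 := by
      refine (real_inner_le_norm _ _).trans ?_
      calc ‖Sginv (y 0 - ystar)‖ * ‖y 0 - ystar‖
          ≤ ‖Sginv‖ * ‖y 0 - ystar‖ * ‖y 0 - ystar‖ := by
            gcongr
            exact Sginv.le_opNorm _
        _ = ‖Sginv‖ * ‖y 0 - ystar‖ ^ 2 := by ring
        _ ≤ ‖Sginv‖ * q₀ ^ 2 := by gcongr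
    have hT := le_abs_self ⟪Tinv (x₀ - xstar), x₀ - xstar⟫
    have hBsq : B ≤ B ^ 2 := by nlinarith
    have hBval : B = 1 + |⟪Tinv (x₀ - xstar), x₀ - xstar⟫| + ‖Sginv‖ * q₀ ^ 2 := rfl
    have hq' : 0 ≤ ‖Sginv‖ * q₀ ^ 2 := by positivity
    have hT' := abs_nonneg ⟪Tinv (x₀ - xstar), x₀ - xstar⟫
    simp only [Vfun, hx0]
    linarith
  have hstep (n : ℕ) (a : ℝ) (ha : 0 ≤ a)
      (hVn : Vfun Tinv Sginv (x n - xstar, y n - ystar) ≤ a ^ 2) :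
      Vfun Tinv Sginv (x (n + 1) - xstar, y (n + 1) - ystar) ≤ a ^ 2 + c * δ + s * δ * a := by
    have hex : (2 : ℝ) • y n - (if n = 0 then ym1 else y (n - 1)) = y n + Sg (A (x n) - bδ) := by
      rcases n with _ | n
      · rw [if_pos rfl, two_smul, hy0, hx0]
        abel
      · rw [if_neg n.succ_ne_zero, Nat.add_sub_cancel, two_smul, hy]
        abel
    have hxn := hx n
    rw [hex] at hxn
    have hvi := hsaddle.forward_backward_step hR hFconv hFgrad hFlip hxn
    have hle := Vfun_step_le hTsymm hSginv hSginv' hSgsa hSgpos hσM.le (fun v => (hSgb v).2) hτM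
      hTinvle hω hA hvi
    rw [← hy] at hle
    have h₁ : σM / 2 * ‖bδ - bstar‖ ^ 2 ≤ σM / 2 * δ := by
      gcongr
      nlinarith [norm_nonneg (bδ - bstar)]
    have h₂ : ‖bδ - bstar‖ * ‖y n - ystar‖ ≤ δ * (s * a) := by
      gcongr
      exact hnorm ha hVn
    have h₃ := (hε (n + 1)).2
    simp only [c]
    linarith
  have hVk := le_sq_of_le_add_mul (V := fun n => Vfun Tinv Sginv (x n - xstar, y n - ystar))
    hB hδ (by positivity) (by positivity) le_rfl hV0 hstep k
  have hyk := hnorm (by positivity) hVk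
  have hy0' := hnorm (by positivity) hV0
  have hdiff : ‖y k - y 0‖ ≤ s * (B + (c + s) * δ * k) + s * B := by
    rw [← sub_sub_sub_cancel_right (y k) (y 0) ystar]
    exact (norm_sub_le _ _).trans (add_le_add hyk hy0')
  have hk0 : (0 : ℝ) < k := by exact_mod_cast hk
  have hres : ‖A ((k : ℝ)⁻¹ • ∑ j ∈ Finset.Icc 1 k, x j) - bstar‖ ≤ P / k + Q * δ := by
    calc ‖A ((k : ℝ)⁻¹ • ∑ j ∈ Finset.Icc 1 k, x j) - bstar‖
        = ‖(k : ℝ)⁻¹ • Sginv (y k - y 0) + (bδ - bstar)‖ := by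
          rw [← map_average_sub_eq hSginv hy hk, sub_add_sub_cancel]
      _ ≤ (k : ℝ)⁻¹ * (‖Sginv‖ * (s * (B + (c + s) * δ * k) + s * B)) + δ := by
          refine (norm_add_le _ _).trans (add_le_add ?_ hbδ)
          rw [norm_smul, norm_inv, Real.norm_natCast]
          gcongr
          exact (Sginv.le_opNorm _).trans (by gcongr)
      _ = P / k + Q * δ := by
          simp only [P, Q]
          field_simp
          ring
  have hPk : (P / k) ^ 2 ≤ P ^ 2 / k := by
    rw [div_pow]
    gcongr
    exact le_self_pow₀ (by exact_mod_cast hk) two_ne_zero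
  calc ‖A ((k : ℝ)⁻¹ • ∑ j ∈ Finset.Icc 1 k, x j) - bstar‖ ^ 2
      ≤ (P / k + Q * δ) ^ 2 := by gcongr
    _ ≤ 2 * ((P / k) ^ 2 + (Q * δ) ^ 2) := add_sq_le
    _ ≤ 2 * (P ^ 2 / k + (Q * δ) ^ 2) := by gcongr
    _ = _ := by ring
end
end

section
/- Let x* ∈ X with R(x*) < ∞ and y* ∈ Y satisfy −A*y* ∈ ∂R(x*), i.e. R(x) ≥ R(x*) + ⟨−A*y*, x − x*⟩ for every x ∈ X. Define the extended support Γ := {i ∈ ℕ : |(A*y*)_i| = 1} and the saturation gap m := sup{|(A*y*)_i| : i ∈ ℕ, |(A*y*)_i| < 1}. Then |(A*y*)_i| ≤ 1 for every i, Γ is a finite set, m < 1, and for every x ∈ X: R(x) − R(x*) + ⟨A*y*, x − x*⟩ ≥ (1 − m)·∑_{i ∉ Γ} |x_i| (an inequality in [0, +∞]). -/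
open scoped RealInnerProductSpace ENNReal NNReal
open Filter Topology

noncomputable section

variable {X Y : Type*}
  [NormedAddCommGroup X] [InnerProductSpace ℝ X] [CompleteSpace X]
  [NormedAddCommGroup Y] [InnerProductSpace ℝ Y] [CompleteSpace Y]

/-- The `ℓ¹`-norm on `ℓ² = lp (fun _ : ℕ => ℝ) 2`, as an extended real number. -/
def l1norm (x : lp (fun _ : ℕ => ℝ) 2) : EReal :=
  ((∑' i : ℕ, (‖x i‖₊ : ℝ≥0∞) : ℝ≥0∞) : EReal)

theorem coe_tsum_nnnorm_eq {ι : Type*} {f : ι → ℝ} (hf : Summable fun i => |f i|) :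
    ((∑' i, (‖f i‖₊ : ℝ≥0∞) : ℝ≥0∞) : EReal) = ((∑' i, |f i| : ℝ) : EReal) := by
  have hn : Summable fun i => ‖f i‖₊ := by
    rw [← NNReal.summable_coe]
    simpa using hf
  rw [← ENNReal.coe_tsum hn, EReal.coe_nnreal_eq_coe_real, NNReal.coe_tsum]
  simp

theorem l1norm_eq_top_of_not_summable {x : lp (fun _ : ℕ => ℝ) 2}
    (hx : ¬ Summable fun i => |x i|) : l1norm x = ⊤ := by
  have : ∑' i : ℕ, (‖x i‖₊ : ℝ≥0∞) = ⊤ := by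
    by_contra h
    rw [← ne_eq, ENNReal.tsum_coe_ne_top_iff_summable, ← NNReal.summable_coe] at h
    exact hx (by simpa using h)
  simp [l1norm, this]

theorem l1norm_single (i : ℕ) (c : ℝ) :
    l1norm (lp.single 2 i c) = ((|c| : ℝ) : EReal) := by
  have h : ∀ j, j ≠ i → |(lp.single 2 i c : lp (fun _ : ℕ => ℝ) 2) j| = 0 := by
    intro j hj
    simp [hj]
  have hs : Summable fun j => |(lp.single 2 i c : lp (fun _ : ℕ => ℝ) 2) j| :=
    summable_of_ne_finset_zero (s := {i}) fun j hj => h j (by simpa using hj)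
  rw [l1norm, coe_tsum_nnnorm_eq hs, tsum_eq_single i h]
  simp

theorem l1norm_add_le (x y : lp (fun _ : ℕ => ℝ) 2) : l1norm (x + y) ≤ l1norm x + l1norm y := by
  simp only [l1norm]
  rw [← EReal.coe_ennreal_add, EReal.coe_ennreal_le_coe_ennreal_iff, ← ENNReal.tsum_add]
  refine ENNReal.tsum_le_tsum fun i => ?_
  exact_mod_cast nnnorm_add_le (x i) (y i)

/-- Coordinates of an `ℓ²` sequence tend to zero. -/
theorem lp_two_tendsto_cofinite_zero (p : lp (fun _ : ℕ => ℝ) 2) :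
    Tendsto (fun i => |p i|) cofinite (𝓝 0) := by
  have h : Summable fun i => |p i| ^ 2 := by
    have := (lp.memℓp p).summable (by norm_num)
    simpa using this
  have h2 := (h.tendsto_cofinite_zero).sqrt
  simpa [Real.sqrt_sq_eq_abs] using h2

theorem lp_two_finite_abs_ge (p : lp (fun _ : ℕ => ℝ) 2) {c : ℝ} (hc : 0 < c) :
    {i : ℕ | c ≤ |p i|}.Finite := by
  have := (lp_two_tendsto_cofinite_zero p).eventually_lt_const hc
  simpa [Filter.eventually_cofinite] using this

theorem sSup_abs_lt_one (p : lp (fun _ : ℕ => ℝ) 2) :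
    sSup {r : ℝ | ∃ i : ℕ, |p i| = r ∧ r < 1} < 1 := by
  have hF : (insert (1 / 2 : ℝ) ((fun i => |p i|) '' {i : ℕ | 1 / 2 ≤ |p i| ∧ |p i| < 1})).Finite :=
    (((lp_two_finite_abs_ge p one_half_pos).subset fun i hi => hi.1).image _).insert _
  obtain ⟨c, hcF, hc⟩ := Set.exists_max_image _ id hF ⟨_, Set.mem_insert _ _⟩
  have hhalf : (1 / 2 : ℝ) ≤ c := hc _ (Set.mem_insert _ _)
  have hc1 : c < 1 := by
    rcases hcF with rfl | ⟨i, hi, rfl⟩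
    · norm_num
    · exact hi.2
  refine lt_of_le_of_lt (Real.sSup_le ?_ (by linarith)) hc1
  rintro r ⟨i, rfl, hr⟩
  rcases le_total (1 / 2) |p i| with h | h
  · exact hc _ (Set.mem_insert_of_mem _ ⟨i, ⟨h, hr⟩, rfl⟩)
  · exact h.trans hhalf

theorem l1norm_add_inner_ge {p x : lp (fun _ : ℕ => ℝ) 2} (hp : ∀ i, |p i| ≤ 1)
    (hx : Summable fun i => |x i|) :
    (1 - sSup {r : ℝ | ∃ i : ℕ, |p i| = r ∧ r < 1}) * ∑' i : {i : ℕ // |p i| ≠ 1}, |x i.1|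
      ≤ ∑' i, |x i| + ⟪p, x⟫ := by
  set m := sSup {r : ℝ | ∃ i : ℕ, |p i| = r ∧ r < 1}
  have hm : ∀ i, |p i| ≠ 1 → |p i| ≤ m := fun i hi =>
    le_csSup ⟨1, by rintro r ⟨-, -, hr⟩; exact hr.le⟩ ⟨i, rfl, lt_of_le_of_ne (hp i) hi⟩
  have hin : HasSum (fun i => p i * x i) ⟪p, x⟫ := by
    simpa [mul_comm] using lp.hasSum_inner (𝕜 := ℝ) p x
  have hind := hx.indicator {i | |p i| ≠ 1}
  rw [show ∑' i : {i : ℕ // |p i| ≠ 1}, |x i.1| = _ from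
      tsum_subtype {i | |p i| ≠ 1} fun i => |x i|, ← tsum_mul_left, ← hin.tsum_eq,
    ← hx.tsum_add hin.summable]
  refine (hind.mul_left _).tsum_le_tsum (fun i => ?_) (hx.add hin.summable)
  have hpx : -(|p i| * |x i|) ≤ p i * x i := by
    rw [← abs_mul]
    exact neg_abs_le _
  by_cases hi : |p i| = 1
  · rw [hi] at hpx
    simp only [Set.mem_ofPred_eq, hi, ne_eq, not_true_eq_false, not_false_eq_true,
      Set.indicator_of_notMem, mul_zero]
    linarith
  · rw [Set.indicator_of_mem (show i ∈ {i | |p i| ≠ 1} from hi)]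
    nlinarith [hm i hi, abs_nonneg (x i)]

theorem summable_of_l1norm_ne_top {x : lp (fun _ : ℕ => ℝ) 2} (hx : l1norm x ≠ ⊤) :
    Summable fun i => |x i| :=
  not_not.mp fun h => hx (l1norm_eq_top_of_not_summable h)

theorem abs_le_one_of_neg_mem_epsSubdiff_l1norm {p z : lp (fun _ : ℕ => ℝ) 2}
    (hfin : l1norm z ≠ ⊤) (hsub : -p ∈ epsSubdiff l1norm 0 z) (i : ℕ) : |p i| ≤ 1 := by
  have key : ∀ c : ℝ, -(p i * c) ≤ |c| := by
    intro c
    have h := (hsub (z + lp.single 2 i c)).trans (l1norm_add_le _ _)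
    rw [l1norm_single, show l1norm z = _ from
      coe_tsum_nnnorm_eq (summable_of_l1norm_ne_top hfin)] at h
    norm_cast at h
    rw [add_sub_cancel_left, inner_neg_left, lp.inner_single_right] at h
    simp only [RCLike.inner_apply, conj_trivial] at h
    linarith
  rw [abs_le]
  have h1 := key 1
  have h2 := key (-1)
  norm_num at h1 h2
  constructor <;> linarith

theorem tsum_abs_add_inner_le_zero {p z : lp (fun _ : ℕ => ℝ) 2}
    (hfin : l1norm z ≠ ⊤) (hsub : -p ∈ epsSubdiff l1norm 0 z) :
    ∑' i, |z i| + ⟪p, z⟫ ≤ 0 := by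
  have h := hsub 0
  have h0 : l1norm 0 = ((0 : ℝ) : EReal) := by simp [l1norm]
  rw [h0, show l1norm z = _ from coe_tsum_nnnorm_eq (summable_of_l1norm_ne_top hfin)] at h
  norm_cast at h
  simpa using h

/-- If `-A* y* ∈ ∂‖·‖₁(x*)` then `|(A* y*)_i| ≤ 1` for all `i`, the extended
support `Γ = {i : |(A* y*)_i| = 1}` is finite, the saturation gap
`m = sup {|(A* y*)_i| : |(A* y*)_i| < 1}` satisfies `m < 1`, and for every `x`,
`R(x) - R(x*) + ⟪A* y*, x - x*⟫ ≥ (1 - m) ∑_{i ∉ Γ} |x_i|` in `[0, +∞]`. -/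
theorem statement_5 {Y : Type*}
    [NormedAddCommGroup Y] [InnerProductSpace ℝ Y] [CompleteSpace Y]
    (A : lp (fun _ : ℕ => ℝ) 2 →L[ℝ] Y)
    (xstar : lp (fun _ : ℕ => ℝ) 2) (ystar : Y)
    (hfin : l1norm xstar ≠ ⊤)
    (hsub : -(ContinuousLinearMap.adjoint A ystar) ∈ epsSubdiff l1norm 0 xstar) :
    (∀ i : ℕ, |ContinuousLinearMap.adjoint A ystar i| ≤ 1) ∧
    {i : ℕ | |ContinuousLinearMap.adjoint A ystar i| = 1}.Finite ∧
    sSup {r : ℝ | ∃ i : ℕ, |ContinuousLinearMap.adjoint A ystar i| = r ∧ r < 1} < 1 ∧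
    ∀ x : lp (fun _ : ℕ => ℝ) 2,
      ((1 - sSup {r : ℝ | ∃ i : ℕ, |ContinuousLinearMap.adjoint A ystar i| = r ∧ r < 1}
          : ℝ) : EReal)
          * ((∑' i : {i : ℕ // |ContinuousLinearMap.adjoint A ystar i| ≠ 1},
              (‖x i.1‖₊ : ℝ≥0∞) : ℝ≥0∞) : EReal)
          + l1norm xstar
        ≤ l1norm x + ((⟪ContinuousLinearMap.adjoint A ystar, x - xstar⟫ : ℝ) : EReal) := by
  set p := ContinuousLinearMap.adjoint A ystar
  have hp := abs_le_one_of_neg_mem_epsSubdiff_l1norm hfin hsub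
  refine ⟨hp, (lp_two_finite_abs_ge p one_pos).subset fun i hi => hi.ge, sSup_abs_lt_one p,
    fun x => ?_⟩
  by_cases hx : Summable fun i => |x i|
  · have h0 := tsum_abs_add_inner_le_zero hfin hsub
    have h1 := l1norm_add_inner_ge hp hx
    have hsubtype : Summable fun i : {i : ℕ // |p i| ≠ 1} => |x i.1| :=
      hx.subtype {i | |p i| ≠ 1}
    rw [coe_tsum_nnnorm_eq hsubtype, show l1norm x = _ from coe_tsum_nnnorm_eq hx,
      show l1norm xstar = _ from coe_tsum_nnnorm_eq (summable_of_l1norm_ne_top hfin),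
      inner_sub_right]
    norm_cast
    linarith
  · rw [l1norm_eq_top_of_not_summable hx, EReal.top_add_coe]
    exact le_top
end
end
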